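/- arXiv:1109.0694 — 10 statements merged into one kernel-verified Lean document; each statement's English description precedes it below -/
import Mathlib

section
/- Every colorable GFT graph is multi-orientable: if a GFT graph (V, α) admits a coloring, then it admits a multi-orientation. -/
open Function

/-- The darts of a GFT graph over the vertex set `V`: each vertex carries four corners. -/
abbrev Dart (V : Type*) := V × ZMod 4

/-- A dart is external when it is fixed by the involution `α`. -/
def IsExternal {V : Type*} (α : Dart V → Dart V) (d : Dart V) : Prop := α d = d

/-- The vertex rotation `σ (v, i) = (v, i + 1)`. -/
def vertexRot {V : Type*} (d : Dart V) : Dart V := (d.1, d.2 + 1)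

/-- The face permutation `φ = σ ∘ α`. -/
def facePerm {V : Type*} (α : Dart V → Dart V) (d : Dart V) : Dart V := vertexRot (α d)

/-- Two darts lie on the same face, i.e. the same orbit of the face permutation `φ = σ ∘ α`. -/
def SameFace {V : Type*} (α : Dart V → Dart V) (d d' : Dart V) : Prop :=
  ∃ n : ℕ, (facePerm α)^[n] d = d'

/-- A multi-orientation of the GFT graph `(V, α)`. -/
def IsMultiOrientation {V : Type*} (α : Dart V → Dart V) (t : Dart V → ZMod 2) : Prop :=
  (∀ (v : V) (i : ZMod 4), t (v, i + 1) = t (v, i) + 1) ∧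
  (∀ d : Dart V, α d ≠ d → t (α d) = t d + 1)

/-- A GFT graph is multi-orientable if it admits a multi-orientation. -/
def MultiOrientable {V : Type*} (α : Dart V → Dart V) : Prop :=
  ∃ t : Dart V → ZMod 2, IsMultiOrientation α t

/-- A coloring of the GFT graph `(V, α)`. -/
def IsColoring {V : Type*} (α : Dart V → Dart V) (ε : V → ZMod 2) (c : Dart V → ZMod 4) : Prop :=
  (∀ (v : V) (i : ZMod 4), ε v = 0 → c (v, i + 1) = c (v, i) + 1) ∧
  (∀ (v : V) (i : ZMod 4), ε v = 1 → c (v, i + 1) = c (v, i) - 1) ∧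
  (∀ d : Dart V, α d ≠ d → c (α d) = c d ∧ ε (α d).1 = ε d.1 + 1)

/-- A GFT graph is colorable if it admits a coloring. -/
def Colorable {V : Type*} (α : Dart V → Dart V) : Prop :=
  ∃ (ε : V → ZMod 2) (c : Dart V → ZMod 4), IsColoring α ε c

/-- Proposition 3.1: every colorable GFT graph is multi-orientable. -/
theorem colorable_implies_multiOrientable {V : Type*} [Fintype V]
    (α : Dart V → Dart V) (hα : Function.Involutive α)
    (h : Colorable α) : MultiOrientable α := by
  obtain ⟨ε, c, h0, h1, hα'⟩ := h
  let π : ZMod 4 →+* ZMod 2 := ZMod.castHom (by decide) (ZMod 2)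
  refine ⟨fun d => ε d.1 + π (c d), fun v i => ?_, fun d hd => ?_⟩
  · have hε : ∀ x : ZMod 2, x = 0 ∨ x = 1 := by decide
    rcases hε (ε v) with hv | hv
    · simp [h0 v i hv, add_assoc]
    · simp [h1 v i hv, CharTwo.sub_eq_add, add_assoc]
  · obtain ⟨hc, hv⟩ := hα' d hd
    simp only [hc, hv]
    ring
end

section
/- Tadfaces are not allowed by multi-orientability: let (V, α) be a multi-orientable GFT graph and let d be an internal dart. If α d lies in the same orbit of the face permutation φ = σ ∘ α as d, then that orbit contains at least one external dart. In particular, if (V, α) is closed (α has no fixed points), then for every dart d, the darts d and α d lie in distinct φ-orbits, i.e. no face traverses any edge twice. -/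
open Function

/-- A multi-orientation is constant along a face that meets no external dart. -/
theorem IsMultiOrientation.iterate_facePerm {V : Type*} {α : Dart V → Dart V}
    {t : Dart V → ZMod 2} (ht : IsMultiOrientation α t) {d : Dart V}
    (hd : ∀ e, SameFace α d e → ¬ IsExternal α e) (n : ℕ) :
    t ((facePerm α)^[n] d) = t d := by
  induction n with
  | zero => rfl
  | succ n ih =>
    rw [iterate_succ_apply', facePerm, vertexRot, ht.1, Prod.mk.eta, ht.2 _ (hd _ ⟨n, rfl⟩),
      add_assoc, CharTwo.add_self_eq_zero, add_zero, ih]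

/-- Theorem 3.1: tadfaces are not allowed by multi-orientability.  If the face through an
internal dart `d` also traverses `α d`, then that face contains an external dart; in
particular a closed multi-orientable graph has no tadface. -/
theorem no_tadface_of_multiOrientable {V : Type*} [Fintype V]
    (α : Dart V → Dart V) (hα : Function.Involutive α)
    (hmo : MultiOrientable α) :
    (∀ d : Dart V, α d ≠ d → SameFace α d (α d) →
      ∃ e : Dart V, SameFace α d e ∧ IsExternal α e) ∧
    ((∀ d : Dart V, α d ≠ d) → ∀ d : Dart V, ¬ SameFace α d (α d)) := by
  obtain ⟨t, ht⟩ := hmo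
  have exists_external : ∀ d : Dart V, α d ≠ d → SameFace α d (α d) →
      ∃ e : Dart V, SameFace α d e ∧ IsExternal α e := by
    rintro d hd ⟨n, hn⟩
    by_contra! h
    have key := ht.iterate_facePerm h n
    rw [hn, ht.2 d hd] at key
    exact one_ne_zero (add_eq_left.mp key)
  refine ⟨exists_external, fun hclosed d hface ↦ ?_⟩
  obtain ⟨e, -, he⟩ := exists_external d (hclosed d) hface
  exact hclosed e he
end

section
/- One cannot have a multi-orientable GFT graph in which a single edge breaks a face: if (V, α) is a multi-orientable GFT graph, then no orbit of the face permutation φ = σ ∘ α contains exactly one external dart. -/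
open Function

theorem facePerm_injective {V : Type*} {α : Dart V → Dart V} (hα : Function.Involutive α) :
    Function.Injective (facePerm α) := by
  intro a b h
  obtain ⟨hfst, hsnd⟩ := Prod.mk.inj h
  exact hα.injective (Prod.ext hfst (add_right_cancel hsnd))

/-- A multi-orientation is preserved by the face permutation at internal darts. -/
theorem IsMultiOrientation.facePerm_of_not_isExternal {V : Type*} {α : Dart V → Dart V}
    {t : Dart V → ZMod 2} (ht : IsMultiOrientation α t) {d : Dart V} (hd : ¬ IsExternal α d) :
    t (facePerm α d) = t d := by
  have h1 : t (facePerm α d) = t (α d) + 1 := ht.1 _ _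
  rw [h1, ht.2 d hd, add_assoc, CharTwo.add_self_eq_zero, add_zero]

/-- A multi-orientation is flipped by the face permutation at external darts. -/
theorem IsMultiOrientation.facePerm_of_isExternal {V : Type*} {α : Dart V → Dart V}
    {t : Dart V → ZMod 2} (ht : IsMultiOrientation α t) {d : Dart V} (hd : IsExternal α d) :
    t (facePerm α d) = t d + 1 := by
  have h1 : t (facePerm α d) = t (α d) + 1 := ht.1 _ _
  rw [h1, show α d = d from hd]

/-- Lemma 3.1: in a multi-orientable GFT graph, no face is broken by exactly one
external dart. -/
theorem no_face_with_single_external_dart {V : Type*} [Fintype V]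
    (α : Dart V → Dart V) (hα : Function.Involutive α)
    (hmo : MultiOrientable α) :
    ∀ d : Dart V, {e : Dart V | SameFace α d e ∧ IsExternal α e}.ncard ≠ 1 := by
  obtain ⟨t, ht⟩ := hmo
  intro d hcard
  obtain ⟨e, he⟩ := Set.ncard_eq_one.mp hcard
  obtain ⟨⟨m, hm⟩, hext⟩ : SameFace α d e ∧ IsExternal α e :=
    he.superset (Set.mem_singleton e)
  have hpos : 0 < minimalPeriod (facePerm α) e :=
    minimalPeriod_pos_of_mem_periodicPts ((facePerm_injective hα).mem_periodicPts e)
  have key : ∀ k, k + 1 ≤ minimalPeriod (facePerm α) e →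
      t ((facePerm α)^[k + 1] e) = t e + 1 := by
    intro k
    induction k with
    | zero => exact fun _ => ht.facePerm_of_isExternal hext
    | succ k ih =>
      intro hk
      rw [iterate_succ_apply', ht.facePerm_of_not_isExternal, ih (by omega)]
      intro hk_ext
      have hmem : (facePerm α)^[k + 1] e ∈ {e : Dart V | SameFace α d e ∧ IsExternal α e} :=
        ⟨⟨k + 1 + m, by rw [iterate_add_apply, hm]⟩, hk_ext⟩
      rw [he] at hmem
      exact not_isPeriodicPt_of_pos_of_lt_minimalPeriod (by omega) (by omega) hmem
  have hreturn := key (minimalPeriod (facePerm α) e - 1) (by omega)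
  rw [Nat.sub_add_cancel hpos, iterate_minimalPeriod] at hreturn
  exact one_ne_zero (left_eq_add.mp hreturn)
end

section
/- In a multi-orientable GFT graph, every broken face is broken by an even number of external edges: if (V, α) is a multi-orientable GFT graph, then every orbit of the face permutation φ = σ ∘ α contains an even number of external darts. -/
open Function

theorem vertexRot_injective {V : Type*} : Injective (vertexRot : Dart V → Dart V) := by
  rintro ⟨v, i⟩ ⟨w, j⟩ h
  simpa [vertexRot] using h

theorem SameFace.facePerm {V : Type*} {α : Dart V → Dart V} {d e : Dart V}
    (h : SameFace α d e) : SameFace α d (facePerm α e) := by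
  obtain ⟨n, rfl⟩ := h
  exact ⟨n + 1, iterate_succ_apply' _ _ _⟩

open Classical in
/-- A multi-orientation changes along the face permutation exactly at the external darts. -/
theorem IsMultiOrientation.apply_facePerm {V : Type*} {α : Dart V → Dart V}
    {t : Dart V → ZMod 2} (ht : IsMultiOrientation α t) (d : Dart V) :
    t (facePerm α d) = t d + if IsExternal α d then 1 else 0 := by
  have h : t (facePerm α d) = t (α d) + 1 := ht.1 _ _
  rw [h]
  split_ifs with hd
  · rw [show α d = d from hd]
  · rw [ht.2 d hd, add_assoc, CharTwo.add_self_eq_zero]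

/-- In a multi-orientable GFT graph, every face contains an even number of external
darts. -/
theorem even_external_darts_per_face {V : Type*} [Fintype V]
    (α : Dart V → Dart V) (hα : Function.Involutive α)
    (hmo : MultiOrientable α) :
    ∀ d : Dart V, Even {e : Dart V | SameFace α d e ∧ IsExternal α e}.ncard := by
  classical
  intro d
  obtain ⟨t, ht⟩ := hmo
  let S : Finset (Dart V) := {e | SameFace α d e}
  have hinj : Injective (facePerm α) := vertexRot_injective.comp hα.injective
  have himage : S.image (facePerm α) = S := by
    refine Finset.eq_of_subset_of_card_le ?_ (Finset.card_image_of_injective S hinj).ge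
    intro e he
    obtain ⟨f, hf, rfl⟩ := Finset.mem_image.mp he
    exact Finset.mem_filter.mpr ⟨Finset.mem_univ _, (Finset.mem_filter.mp hf).2.facePerm⟩
  have hsum : ∑ e ∈ S, t (facePerm α e) = ∑ e ∈ S, t e := by
    conv_rhs => rw [← himage, Finset.sum_image hinj.injOn]
  simp only [ht.apply_facePerm, Finset.sum_add_distrib, add_eq_left, Finset.sum_boole] at hsum
  have hset : {e : Dart V | SameFace α d e ∧ IsExternal α e} =
      ↑(S.filter (IsExternal α)) := by
    ext e
    simp [S]
  rw [hset, Set.ncard_coe_finset]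
  exact (ZMod.natCast_eq_zero_iff_even).mp hsum
end

section
/- ``Non-planar'' generalized tadpoles are not allowed by colorability: if (V, α) is a colorable GFT graph with exactly two external darts, then the two external darts lie in the same orbit of the face permutation φ = σ ∘ α (i.e. a colorable two-point graph has exactly one broken face). -/
open Function

/-- A coloring induces a multi-orientation: add the parity of the color to `ε`. -/
theorem IsColoring.isMultiOrientation {V : Type*} {α : Dart V → Dart V} {ε : V → ZMod 2}
    {c : Dart V → ZMod 4} (h : IsColoring α ε c) :
    IsMultiOrientation α fun d =>
      ZMod.castHom (show 2 ∣ 4 by norm_num) (ZMod 2) (c d) + ε d.1 := by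
  obtain ⟨h₀, h₁, hα⟩ := h
  refine ⟨fun v i => ?_, fun d hd => ?_⟩
  · have hε : ∀ x : ZMod 2, x = 0 ∨ x = 1 := by decide
    rcases hε (ε v) with hv | hv
    · simp only [h₀ v i hv, map_add, map_one]
      ring
    · simp only [h₁ v i hv, map_sub, map_one, CharTwo.sub_eq_add]
      ring
  · obtain ⟨hc, hε⟩ := hα d hd
    simp only [hc, hε]
    ring

theorem Colorable.multiOrientable {V : Type*} {α : Dart V → Dart V} (h : Colorable α) :
    MultiOrientable α :=
  let ⟨_, _, hc⟩ := h
  ⟨_, hc.isMultiOrientation⟩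

/-- Corollary 3.3: "non-planar" generalized tadpoles are not allowed by colorability.
In a colorable GFT graph with exactly two external darts, the two external darts lie
on the same face. -/
theorem two_point_one_broken_face_of_colorable {V : Type*} [Fintype V]
    (α : Dart V → Dart V) (hα : Function.Involutive α)
    (hcol : Colorable α)
    (d₁ d₂ : Dart V) (h₁ : IsExternal α d₁) (h₂ : IsExternal α d₂) (hne : d₁ ≠ d₂)
    (hall : ∀ d : Dart V, IsExternal α d → d = d₁ ∨ d = d₂) :
    SameFace α d₁ d₂ := by
  by_contra hface
  obtain ⟨t, ht⟩ := hcol.multiOrientable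
  have hinj : Injective (facePerm α) := vertexRot_injective.comp hα.injective
  have hpos : 0 < minimalPeriod (facePerm α) d₁ :=
    minimalPeriod_pos_of_mem_periodicPts (hinj.mem_periodicPts d₁)
  have hflip : ∀ n, n + 1 ≤ minimalPeriod (facePerm α) d₁ →
      t ((facePerm α)^[n + 1] d₁) = t d₁ + 1 := by
    intro n
    induction n with
    | zero => exact fun _ => ht.facePerm_of_isExternal h₁
    | succ n ih =>
      intro hn
      rw [iterate_succ_apply', ht.facePerm_of_not_isExternal, ih (by omega)]
      intro hext
      rcases hall _ hext with h | h
      · exact not_isPeriodicPt_of_pos_of_lt_minimalPeriod n.succ_ne_zero (by omega) h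
      · exact hface ⟨_, h⟩
  have h := hflip (minimalPeriod (facePerm α) d₁ - 1) (by omega)
  rw [Nat.sub_add_cancel hpos, iterate_minimalPeriod] at h
  simp at h
end

section
/- No two-point function of type φφ or φ̄φ̄ is permitted by multi-orientability: let (V, α) be a GFT graph with exactly two external darts d₁ ≠ d₂, and let t be any multi-orientation of (V, α). Then t(d₁) ≠ t(d₂), i.e. one external leg is of type φ and the other of type φ̄. -/
open Function

/-- The sign attached to an element of `ZMod 2`: `1` at `0` and `-1` at `1`. -/
def zmodTwoSign (x : ZMod 2) : ℤ := if x = 0 then 1 else -1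

theorem zmodTwoSign_add_one (x : ZMod 2) : zmodTwoSign (x + 1) = -zmodTwoSign x := by
  revert x; decide

theorem zmodTwoSign_ne_zero (x : ZMod 2) : zmodTwoSign x ≠ 0 := by
  revert x; decide

/-- The signs of a multi-orientation cancel over the set of all darts, since the vertex rotation
flips them. -/
theorem IsMultiOrientation.sum_sign_eq_zero {V : Type*} [Fintype V] {α : Dart V → Dart V}
    {t : Dart V → ZMod 2} (ht : IsMultiOrientation α t) :
    ∑ d, zmodTwoSign (t d) = 0 := by
  have hrot := Equiv.sum_comp ((Equiv.refl V).prodCongr (Equiv.addRight (1 : ZMod 4)))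
    fun d => zmodTwoSign (t d)
  have hneg : ∑ d : Dart V, zmodTwoSign (t (d.1, d.2 + 1)) = -∑ d, zmodTwoSign (t d) := by
    rw [← Finset.sum_neg_distrib]
    exact Finset.sum_congr rfl fun d _ => by rw [ht.1, zmodTwoSign_add_one]
  have heq : ∑ d : Dart V, zmodTwoSign (t (d.1, d.2 + 1)) = ∑ d, zmodTwoSign (t d) := hrot
  linarith

open Classical in
/-- The signs of a multi-orientation cancel over the set of external darts. -/
theorem IsMultiOrientation.sum_sign_external_eq_zero {V : Type*} [Fintype V]
    {α : Dart V → Dart V} (hα : Function.Involutive α)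
    {t : Dart V → ZMod 2} (ht : IsMultiOrientation α t) :
    ∑ d with IsExternal α d, zmodTwoSign (t d) = 0 := by
  have hinv : ∑ d, zmodTwoSign (t (α d)) = ∑ d, zmodTwoSign (t d) :=
    Equiv.sum_comp (hα.toPerm α) fun d => zmodTwoSign (t d)
  have hpair : ∑ d, (zmodTwoSign (t d) + zmodTwoSign (t (α d))) =
      2 * ∑ d with IsExternal α d, zmodTwoSign (t d) := by
    rw [Finset.mul_sum, Finset.sum_filter]
    refine Finset.sum_congr rfl fun d _ => ?_
    split_ifs with hd
    · rw [show α d = d from hd, two_mul]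
    · rw [ht.2 d hd, zmodTwoSign_add_one, add_neg_cancel]
  rw [Finset.sum_add_distrib, hinv, ht.sum_sign_eq_zero] at hpair
  linarith

/-- Theorem 5.1 (first part): no two-point function of type `φφ` or `φ̄φ̄` is permitted
by multi-orientability.  In a GFT graph with exactly two external darts, any
multi-orientation assigns opposite signs to the two external darts. -/
theorem two_point_opposite_types {V : Type*} [Fintype V]
    (α : Dart V → Dart V) (hα : Function.Involutive α)
    (t : Dart V → ZMod 2) (ht : IsMultiOrientation α t)
    (d₁ d₂ : Dart V) (h₁ : IsExternal α d₁) (h₂ : IsExternal α d₂) (hne : d₁ ≠ d₂)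
    (hall : ∀ d : Dart V, IsExternal α d → d = d₁ ∨ d = d₂) :
    t d₁ ≠ t d₂ := by
  classical
  intro h
  have hsum := ht.sum_sign_external_eq_zero hα
  have hext : ({d | IsExternal α d} : Finset (Dart V)) = {d₁, d₂} := by
    ext d
    simp only [Finset.mem_filter_univ, Finset.mem_insert, Finset.mem_singleton]
    refine ⟨hall d, ?_⟩
    rintro (rfl | rfl) <;> assumption
  rw [hext, Finset.sum_pair hne, h] at hsum
  exact zmodTwoSign_ne_zero (t d₂) (by linarith)
end

section
/- No four-point function of a type distinct from φφ̄φφ̄ is permitted by multi-orientability: let (V, α) be a GFT graph with exactly four external darts, and let t be any multi-orientation of (V, α). Then exactly two of the four external darts satisfy t(d) = 0 and exactly two satisfy t(d) = 1, i.e. exactly two external legs are of type φ and two of type φ̄. -/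
open Function

/-- The sign attached to a leg type: `1` for `φ` and `-1` for `φ̄`. -/
def legSign (a : ZMod 2) : ℤ := if a = 0 then 1 else -1

theorem legSign_add_one (a : ZMod 2) : legSign (a + 1) = -legSign a := by
  revert a; decide

/-- A multi-orientation is balanced over all darts. -/
theorem IsMultiOrientation.sum_legSign {V : Type*} [Fintype V] {α : Dart V → Dart V}
    {t : Dart V → ZMod 2} (ht : IsMultiOrientation α t) :
    ∑ d : Dart V, legSign (t d) = 0 := by
  have hrot : ∑ d : Dart V, legSign (t (d.1, d.2 + 1)) = ∑ d : Dart V, legSign (t d) :=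
    Equiv.sum_comp ((Equiv.refl V).prodCongr (Equiv.addRight (1 : ZMod 4)))
      (fun d => legSign (t d))
  simp only [ht.1, legSign_add_one, Finset.sum_neg_distrib] at hrot
  linarith

open Classical in
/-- A multi-orientation is balanced over the external darts. -/
theorem IsMultiOrientation.sum_legSign_external {V : Type*} [Fintype V] {α : Dart V → Dart V}
    (hα : Function.Involutive α) {t : Dart V → ZMod 2} (ht : IsMultiOrientation α t) :
    ∑ d : Dart V with IsExternal α d, legSign (t d) = 0 := by
  have hinv : ∑ d : Dart V, legSign (t (α d)) = ∑ d : Dart V, legSign (t d) :=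
    Equiv.sum_comp hα.toPerm (fun d => legSign (t d))
  have hpt (d : Dart V) : legSign (t d) + legSign (t (α d)) =
      2 * if IsExternal α d then legSign (t d) else 0 := by
    split_ifs with h
    · rw [show α d = d from h]; ring
    · rw [ht.2 d h, legSign_add_one]; ring
  have hsum := Finset.sum_congr rfl fun (d : Dart V) (_ : d ∈ Finset.univ) => hpt d
  rw [Finset.sum_add_distrib, hinv, ht.sum_legSign, ← Finset.mul_sum] at hsum
  rw [Finset.sum_filter]
  linarith

open Classical in
/-- As many external darts carry the value `0` as carry the value `1`. -/
theorem IsMultiOrientation.card_external_eq {V : Type*} [Fintype V] {α : Dart V → Dart V}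
    (hα : Function.Involutive α) {t : Dart V → ZMod 2} (ht : IsMultiOrientation α t) :
    {d : Dart V | IsExternal α d ∧ t d = 0}.ncard =
      {d : Dart V | IsExternal α d ∧ t d = 1}.ncard := by
  have hne (a : ZMod 2) : a ≠ 0 ↔ a = 1 := by revert a; decide
  have h := ht.sum_legSign_external hα
  simp only [legSign, Finset.sum_ite, Finset.filter_filter, Finset.sum_const, nsmul_eq_mul,
    mul_one, mul_neg, hne] at h
  simp only [Set.ncard_eq_toFinset_card', Set.toFinset_ofPred]
  lia

/-- Theorem 5.1 (second part): no four-point function of a type distinct from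
`φφ̄φφ̄` is permitted by multi-orientability.  In a GFT graph with exactly four
external darts, any multi-orientation assigns the value `0` to exactly two of them
and the value `1` to exactly two of them. -/
theorem four_point_balanced_types {V : Type*} [Fintype V]
    (α : Dart V → Dart V) (hα : Function.Involutive α)
    (t : Dart V → ZMod 2) (ht : IsMultiOrientation α t)
    (d₁ d₂ d₃ d₄ : Dart V)
    (h₁ : IsExternal α d₁) (h₂ : IsExternal α d₂)
    (h₃ : IsExternal α d₃) (h₄ : IsExternal α d₄)
    (hne : d₁ ≠ d₂ ∧ d₁ ≠ d₃ ∧ d₁ ≠ d₄ ∧ d₂ ≠ d₃ ∧ d₂ ≠ d₄ ∧ d₃ ≠ d₄)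
    (hall : ∀ d : Dart V, IsExternal α d → d = d₁ ∨ d = d₂ ∨ d = d₃ ∨ d = d₄) :
    {d : Dart V | IsExternal α d ∧ t d = 0}.ncard = 2 ∧
    {d : Dart V | IsExternal α d ∧ t d = 1}.ncard = 2 := by
  have hset : {d : Dart V | IsExternal α d} = {d₁, d₂, d₃, d₄} := by
    ext d
    simp only [Set.mem_ofPred_eq, Set.mem_insert_iff, Set.mem_singleton_iff]
    refine ⟨hall d, ?_⟩
    rintro (rfl | rfl | rfl | rfl) <;> assumption
  have hcard : {d : Dart V | IsExternal α d}.ncard = 4 := by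
    classical
    obtain ⟨h12, h13, h14, h23, h24, h34⟩ := hne
    rw [hset, Set.ncard_eq_toFinset_card']
    simp [*]
  have hunion : {d : Dart V | IsExternal α d} =
      {d : Dart V | IsExternal α d ∧ t d = 0} ∪ {d : Dart V | IsExternal α d ∧ t d = 1} := by
    have hcases (a : ZMod 2) : a = 0 ∨ a = 1 := by revert a; decide
    ext d
    simp only [Set.mem_ofPred_eq, Set.mem_union, ← and_or_left, hcases, and_true]
  have hdisj : Disjoint {d : Dart V | IsExternal α d ∧ t d = 0}
      {d : Dart V | IsExternal α d ∧ t d = 1} := by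
    rw [Set.disjoint_left]
    rintro d ⟨_, h0⟩ ⟨_, h1⟩
    exact zero_ne_one (h0.symm.trans h1)
  rw [hunion, Set.ncard_union_eq hdisj (Set.toFinite _) (Set.toFinite _)] at hcard
  have heq := ht.card_external_eq hα
  lia
end

section
/- In any multi-orientable GFT graph the external legs are balanced between the two field types: let (V, α) be a GFT graph and let t be any multi-orientation of (V, α). Then the number of external darts d with t(d) = 0 equals the number of external darts d with t(d) = 1. -/
open Function

/-- Two subsets of a finite type that inject into each other have the same cardinality. -/
theorem ncard_eq_of_injective_mapsTo {D : Type*} [Finite D] {f g : D → D} {A B : Set D}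
    (hf : Injective f) (hg : Injective g) (hAB : Set.MapsTo f A B) (hBA : Set.MapsTo g B A) :
    A.ncard = B.ncard :=
  le_antisymm
    (Set.ncard_le_ncard_of_injOn f hAB hf.injOn (Set.toFinite B))
    (Set.ncard_le_ncard_of_injOn g hBA hg.injOn (Set.toFinite A))

/-- The vertex rotation exchanges the two signs, so each sign is carried by half of the darts. -/
theorem ncard_sign_eq {V : Type*} [Finite V] {α : Dart V → Dart V} {t : Dart V → ZMod 2}
    (ht : IsMultiOrientation α t) : {d | t d = 0}.ncard = {d | t d = 1}.ncard := by
  have hrot (d : Dart V) : t (vertexRot d) = t d + 1 := ht.1 d.1 d.2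
  refine ncard_eq_of_injective_mapsTo vertexRot_injective vertexRot_injective ?_ ?_ <;>
  · intro d (hd : t d = _)
    rw [Set.mem_ofPred_eq, hrot, hd]
    decide

/-- The involution exchanges the two signs on internal darts. -/
theorem ncard_internal_sign_eq {V : Type*} [Finite V] {α : Dart V → Dart V}
    (hα : Involutive α) {t : Dart V → ZMod 2} (ht : IsMultiOrientation α t) :
    {d | ¬ IsExternal α d ∧ t d = 0}.ncard = {d | ¬ IsExternal α d ∧ t d = 1}.ncard := by
  have hint {d : Dart V} (hd : ¬ IsExternal α d) : ¬ IsExternal α (α d) :=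
    fun h => hd (hα.injective h)
  refine ncard_eq_of_injective_mapsTo hα.injective hα.injective ?_ ?_ <;>
  · rintro d ⟨hd, htd⟩
    refine ⟨hint hd, ?_⟩
    rw [ht.2 d hd, htd]
    decide

/-- In any multi-orientable GFT graph, the external legs are balanced between the two
field types: the number of external darts of type `φ` (value `0`) equals the number of
external darts of type `φ̄` (value `1`). -/
theorem external_darts_balanced {V : Type*} [Fintype V]
    (α : Dart V → Dart V) (hα : Function.Involutive α)
    (t : Dart V → ZMod 2) (ht : IsMultiOrientation α t) :
    {d : Dart V | IsExternal α d ∧ t d = 0}.ncard =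
      {d : Dart V | IsExternal α d ∧ t d = 1}.ncard := by
  have hsplit (a : ZMod 2) : {d | IsExternal α d ∧ t d = a}.ncard +
      {d | ¬ IsExternal α d ∧ t d = a}.ncard = {d | t d = a}.ncard := by
    rw [← Set.ncard_union_eq]
    · congr 1
      ext d
      simp only [Set.mem_union, Set.mem_ofPred_eq]
      tauto
    · rw [Set.disjoint_left]
      exact fun d h h' => h'.1 h.1
  have h₀ := hsplit 0
  have h₁ := hsplit 1
  have hall := ncard_sign_eq ht
  have hint := ncard_internal_sign_eq hα ht
  omega
end

section
/- The converse of Proposition 3.1 fails: there exists a GFT graph that is multi-orientable but not colorable. Concretely, let V = {v} be a single vertex and let α : D → D be the involution swapping the darts (v, 0) and (v, 1) and fixing (v, 2) and (v, 3). Then the GFT graph (V, α) (the planar tadpole) is multi-orientable but is not colorable. -/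
open Function

/-- The involution of the planar tadpole of Figure 4: a single vertex whose corners
`0` and `1` are joined by an edge, the corners `2` and `3` remaining external. -/
def tadpoleInv : Dart Unit → Dart Unit := fun d =>
  if d.2 = 0 then (d.1, 1) else if d.2 = 1 then (d.1, 0) else d

/-- The converse of Proposition 3.1 fails: the planar tadpole is multi-orientable but
not colorable. -/
theorem tadpole_multiOrientable_not_colorable :
    MultiOrientable tadpoleInv ∧ ¬ Colorable tadpoleInv := by
  refine ⟨⟨fun d => ZMod.castHom (by decide : 2 ∣ 4) (ZMod 2) d.2, ?_, ?_⟩, ?_⟩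
  · intro v i
    simp only [map_add, map_one]
  · decide
  · rintro ⟨ε, c, -, -, h⟩
    have hε : ε () = ε () + 1 := (h ((), 0) (by decide)).2
    exact one_ne_zero (left_eq_add.mp hε)
end

section
/- Feynman amplitude of the non-colorable, multi-orientable four-point graph (Figure 7): let G be a group and let g₁, g₂, g₄, g₅, g₁', g₂', g₄', g₅' ∈ G. Then there exist h₁, h₂ ∈ G satisfying the four propagator constraints g₁ h₁ h₂⁻¹ g₅ = 1, g₄ h₁ g₄'⁻¹ = 1, g₂ h₂ g₂'⁻¹ = 1, and g₁'⁻¹ h₁⁻¹ h₂ g₅'⁻¹ = 1 if and only if the two external relations g₁ g₄⁻¹ g₄' g₂'⁻¹ g₂ g₅ = 1 and g₁'⁻¹ g₄'⁻¹ g₄ g₂⁻¹ g₂' g₅'⁻¹ = 1 hold; moreover, when a solution exists it is unique, given by h₁ = g₄⁻¹ g₄' and h₂ = g₂⁻¹ g₂'. -/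
/-- A constraint `a * h * b⁻¹ = 1` determines `h`. -/
theorem mul_mul_inv_eq_one_iff_eq_inv_mul {G : Type*} [Group G] {a h b : G} :
    a * h * b⁻¹ = 1 ↔ h = a⁻¹ * b := by
  rw [mul_inv_eq_one, eq_inv_mul_iff_mul_eq]

/-- Feynman amplitude of the non-colorable, multi-orientable four-point GFT graph of
Figure 7: the propagator constraint system in the internal group elements `h₁, h₂` is
solvable iff the two external relations hold, and the solution is then unique, given by
`h₁ = g₄⁻¹ g₄'` and `h₂ = g₂⁻¹ g₂'`. -/
theorem amplitude_noncolorable_multiOrientable_four_point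
    {G : Type*} [Group G] (g₁ g₂ g₄ g₅ g₁' g₂' g₄' g₅' : G) :
    ((∃ h₁ h₂ : G,
        g₁ * h₁ * h₂⁻¹ * g₅ = 1 ∧
        g₄ * h₁ * g₄'⁻¹ = 1 ∧
        g₂ * h₂ * g₂'⁻¹ = 1 ∧
        g₁'⁻¹ * h₁⁻¹ * h₂ * g₅'⁻¹ = 1) ↔
      (g₁ * g₄⁻¹ * g₄' * g₂'⁻¹ * g₂ * g₅ = 1 ∧
        g₁'⁻¹ * g₄'⁻¹ * g₄ * g₂⁻¹ * g₂' * g₅'⁻¹ = 1)) ∧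
    (∀ h₁ h₂ : G,
      g₁ * h₁ * h₂⁻¹ * g₅ = 1 →
      g₄ * h₁ * g₄'⁻¹ = 1 →
      g₂ * h₂ * g₂'⁻¹ = 1 →
      g₁'⁻¹ * h₁⁻¹ * h₂ * g₅'⁻¹ = 1 →
      h₁ = g₄⁻¹ * g₄' ∧ h₂ = g₂⁻¹ * g₂') := by
  simp only [mul_mul_inv_eq_one_iff_eq_inv_mul (a := g₄),
    mul_mul_inv_eq_one_iff_eq_inv_mul (a := g₂)]
  refine ⟨⟨?_, fun ⟨e₁, e₂⟩ => ⟨g₄⁻¹ * g₄', g₂⁻¹ * g₂', ?_, rfl, rfl, ?_⟩⟩,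
    fun _ _ _ k₁ k₂ _ => ⟨k₁, k₂⟩⟩
  · rintro ⟨_, _, e₁, rfl, rfl, e₂⟩
    exact ⟨by simpa [mul_assoc] using e₁, by simpa [mul_assoc] using e₂⟩
  · simpa [mul_assoc] using e₁
  · simpa [mul_assoc] using e₂
end
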